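/- Let T, K > 0 and let u₀(x) = −x^{−1/2} for x > 0 and u₀(x) = 0 for x ≤ 0. Let u be a weak solution of u_t + (x u²)_x = 0 on ℝ × (0,T) with initial datum u₀ such that u(x,t) = 0 for a.e. (x,t) ∈ (−∞,0) × (0,T) and u(x,t) = −x^{−1/2} for a.e. x > K and a.e. t ∈ (0,T). Then for a.e. t ∈ (0,T), the function x ↦ u(x,t) + x^{−1/2} is integrable on (0,∞) and ∫₀^∞ ( u(x,t) + x^{−1/2} ) dx = −t. -/

import Mathlib

open MeasureTheory Set Filter

/-- `u` is a weak solution of `u_t + (x u²)_x = 0` on `ℝ × (0,T)` with initial datum `u₀`: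
`u` and the flux `x u²` are locally integrable on the strip, and the integral identity holds
for every smooth compactly supported test function with support in `ℝ × (−∞,T)`.
Points of `ℝ × ℝ` are written `(x, t)`. -/
def IsWeakSolution (T : ℝ) (u : ℝ × ℝ → ℝ) (u₀ : ℝ → ℝ) : Prop :=
  LocallyIntegrableOn u (univ ×ˢ Ioo 0 T) volume ∧
  LocallyIntegrableOn (fun p => p.1 * (u p) ^ 2) (univ ×ˢ Ioo 0 T) volume ∧
  ∀ φ : ℝ × ℝ → ℝ, ContDiff ℝ (⊤ : ℕ∞) φ → HasCompactSupport φ →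
    tsupport φ ⊆ univ ×ˢ Iio T →
    (∫ t in Ioo (0 : ℝ) T, ∫ x : ℝ,
        (u (x, t) * fderiv ℝ φ (x, t) (0, 1)
          + x * (u (x, t)) ^ 2 * fderiv ℝ φ (x, t) (1, 0)))
      + ∫ x : ℝ, u₀ x * φ (x, 0) = 0

open scoped ContDiff

lemma aux_swap_ae {P : ℝ × ℝ → Prop} (h : ∀ᵐ p : ℝ × ℝ, P p) :
    ∀ᵐ t : ℝ, ∀ᵐ x : ℝ, P (x, t) := by
  have h1 : ∀ᵐ q ∂((volume : Measure ℝ).prod (volume : Measure ℝ)), P q.swap :=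
    (Measure.measurePreserving_swap (μ := (volume : Measure ℝ))
      (ν := (volume : Measure ℝ))).quasiMeasurePreserving.ae h
  exact Measure.ae_ae_of_ae_prod h1

/-- Integrability of `u χ` on `ℝ × k`. -/
lemma aux_prod_int {T : ℝ} {u : ℝ × ℝ → ℝ}
    (hu : LocallyIntegrableOn u (univ ×ˢ Ioo 0 T) volume)
    {χ : ℝ → ℝ} (hχ : Continuous χ) (hχc : HasCompactSupport χ)
    {k : Set ℝ} (hk : IsCompact k) (hkT : k ⊆ Ioo 0 T) :
    Integrable (fun p : ℝ × ℝ => u p * χ p.1)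
      ((volume : Measure ℝ).prod ((volume : Measure ℝ).restrict k)) := by
  have hc : IsCompact (tsupport χ ×ˢ k) := hχc.isCompact.prod hk
  have h1 : IntegrableOn u (tsupport χ ×ˢ k) volume :=
    hu.integrableOn_compact_subset (prod_mono (subset_univ _) hkT) hc
  have h2 : IntegrableOn (fun p : ℝ × ℝ => u p * χ p.1) (tsupport χ ×ˢ k) volume :=
    h1.mul_continuousOn (hχ.comp continuous_fst).continuousOn hc
  have h3 : IntegrableOn (fun p : ℝ × ℝ => u p * χ p.1) (univ ×ˢ k) volume := by
    refine h2.of_forall_sdiff_eq_zero (MeasurableSet.univ.prod hk.measurableSet) ?_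
    rintro ⟨x, t⟩ ⟨h, h'⟩
    have : x ∉ tsupport χ := fun hx => h' ⟨hx, h.2⟩
    simp [image_eq_zero_of_notMem_tsupport this]
  have h4 : (volume : Measure (ℝ × ℝ)).restrict (univ ×ˢ k)
      = (volume : Measure ℝ).prod ((volume : Measure ℝ).restrict k) := by
    rw [Measure.volume_eq_prod, ← Measure.prod_restrict, Measure.restrict_univ]
  rw [← h4]; exact h3

lemma aux_slice {T : ℝ} {u : ℝ × ℝ → ℝ}
    (hu : LocallyIntegrableOn u (univ ×ˢ Ioo 0 T) volume)
    {χ : ℝ → ℝ} (hχ : Continuous χ) (hχc : HasCompactSupport χ) :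
    ∀ᵐ t ∂(volume.restrict (Ioo 0 T)), Integrable (fun x => u (x, t) * χ x) volume := by
  have hsub : Ioo 0 T ⊆ ⋃ n : ℕ, Icc (1 / ((n : ℝ) + 1)) (T - 1 / ((n : ℝ) + 1)) := by
    intro t ht
    obtain ⟨n, hn⟩ := exists_nat_one_div_lt (lt_min ht.1 (sub_pos.2 ht.2))
    refine mem_iUnion.2 ⟨n, ?_, ?_⟩
    · exact (hn.trans_le (min_le_left _ _)).le
    · have := hn.trans_le (min_le_right _ _)
      linarith
  refine ae_restrict_of_ae_restrict_of_subset hsub ?_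
  rw [ae_restrict_iUnion_iff]
  intro n
  have hp : 0 < 1 / ((n : ℝ) + 1) := by positivity
  exact (aux_prod_int hu hχ hχc isCompact_Icc
    (fun t ht => ⟨hp.trans_le ht.1, by linarith [ht.2]⟩)).prod_left_ae

lemma aux_M_loc {T : ℝ} {u : ℝ × ℝ → ℝ}
    (hu : LocallyIntegrableOn u (univ ×ˢ Ioo 0 T) volume)
    {χ : ℝ → ℝ} (hχ : Continuous χ) (hχc : HasCompactSupport χ) :
    LocallyIntegrableOn (fun t => ∫ x, u (x, t) * χ x) (Ioo 0 T) volume := by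
  rw [locallyIntegrableOn_iff isOpen_Ioo.isLocallyClosed]
  intro k hk hkc
  exact (aux_prod_int hu hχ hχc hkc hk).integral_prod_right

/-- Primitive of `g` vanishing near `T`. -/
lemma aux_psi {T : ℝ} (hT : 0 < T) {g : ℝ → ℝ} (hg : ContDiff ℝ ∞ g)
    (hgc : HasCompactSupport g) (hgT : tsupport g ⊆ Ioo 0 T) :
    ∃ G : ℝ → ℝ, ContDiff ℝ ∞ G ∧ (∀ t, HasDerivAt G (g t) t) ∧ G 0 = - ∫ t in 0..T, g t ∧
      G T = 0 ∧ ∃ b < T, ∀ t, b < t → G t = 0 := by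
  obtain ⟨b, hb, hbub⟩ := (hgc.isCompact.union (isCompact_singleton (x := T / 2))).exists_isGreatest
    ⟨T / 2, by simp⟩
  have hbT : b ∈ Ioo 0 T := by
    rcases hb with hb | hb
    · exact hgT hb
    · rw [mem_singleton_iff.1 hb]; constructor <;> linarith
  have hg0 : ∀ t, b < t → g t = 0 := fun t ht =>
    image_eq_zero_of_notMem_tsupport fun h => absurd (hbub (Or.inl h)) (not_le.2 ht)
  have hd : ∀ t, HasDerivAt (fun t => ∫ s in T..t, g s) (g t) t := fun t =>
    intervalIntegral.integral_hasDerivAt_right (hg.continuous.intervalIntegrable _ _)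
      (hg.continuous.stronglyMeasurableAtFilter _ _) hg.continuous.continuousAt
  refine ⟨fun t => ∫ s in T..t, g s, ?_, hd, ?_, ?_, b, hbT.2, ?_⟩
  · rw [contDiff_infty_iff_deriv]
    refine ⟨fun t => (hd t).differentiableAt, ?_⟩
    rw [show deriv (fun t => ∫ s in T..t, g s) = g from funext fun t => (hd t).deriv]
    exact hg
  · exact intervalIntegral.integral_symm _ _
  · simp
  · intro t ht
    apply intervalIntegral.integral_zero_ae
    refine Eventually.of_forall fun s hs => hg0 s ?_
    exact (lt_min hbT.2 ht).trans hs.1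

lemma aux_weight (χ : ℝ → ℝ) (hχ : Continuous χ) (hχc : HasCompactSupport χ) :
    IntegrableOn (fun x => (Real.sqrt x)⁻¹ * χ x) (Ioi 0) volume := by
  obtain ⟨R, hR⟩ := hχc.isCompact.isBounded.subset_closedBall 0
  have h1 : IntegrableOn (fun x : ℝ => (Real.sqrt x)⁻¹) (Ioc 0 |R|) volume := by
    have := (intervalIntegral.intervalIntegrable_rpow' (a := 0) (b := |R|)
      (r := -(1/2 : ℝ)) (by norm_num))
    rw [intervalIntegrable_iff_integrableOn_Ioc_of_le (abs_nonneg R)] at this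
    refine this.congr_fun (fun x hx => ?_) measurableSet_Ioc
    simp only
    rw [Real.rpow_neg hx.1.le, Real.sqrt_eq_rpow]
  have h2 : IntegrableOn (fun x => (Real.sqrt x)⁻¹ * χ x) (Ioc 0 |R|) volume :=
    h1.mul_continuousOn_of_subset hχ.continuousOn measurableSet_Ioc isCompact_Icc
      Ioc_subset_Icc_self
  refine h2.of_forall_sdiff_eq_zero measurableSet_Ioi ?_
  rintro x ⟨hx, hx'⟩
  have : x ∉ tsupport χ := fun h => by
    have h3 := hR h
    rw [Metric.mem_closedBall, Real.dist_eq, sub_zero] at h3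
    exact hx' ⟨hx, (le_abs_self x).trans (h3.trans (le_abs_self R))⟩
  simp [image_eq_zero_of_notMem_tsupport this]

/-- The product test function. -/
lemma aux_test {T : ℝ} (hT : 0 < T) {u : ℝ × ℝ → ℝ} {u₀ : ℝ → ℝ} (hu : IsWeakSolution T u u₀)
    {χ : ℝ → ℝ} (hχ : ContDiff ℝ ∞ χ) (hχc : HasCompactSupport χ)
    {g G : ℝ → ℝ} (hG : ContDiff ℝ ∞ G) (hd : ∀ t, HasDerivAt G (g t) t)
    (hz : ∃ b < T, ∀ t, b < t → G t = 0) :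
    (∫ t in Ioo (0 : ℝ) T, ∫ x : ℝ, (u (x, t) * (χ x * g t)
          + x * (u (x, t)) ^ 2 * (deriv χ x * G t)))
      + ∫ x : ℝ, u₀ x * (χ x * G 0) = 0 := by
  obtain ⟨b, hbT, hb⟩ := hz
  let η : ContDiffBump (0 : ℝ) := ⟨T + 1, T + 2, by linarith, by linarith⟩
  have hη1 : ∀ t ∈ Icc 0 T, (fun s => η s) =ᶠ[nhds t] fun _ => (1 : ℝ) := fun t ht => by
    apply ContDiffBump.eventuallyEq_one_of_mem_ball
    rw [Metric.mem_ball, Real.dist_eq, sub_zero, abs_of_nonneg ht.1]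
    change t < T + 1
    linarith [ht.2]
  set φ : ℝ × ℝ → ℝ := fun p => χ p.1 * (η p.2 * G p.2) with hφ
  have hφs : ContDiff ℝ ∞ φ := by
    have : ContDiff ℝ ∞ (fun t => η t) := η.contDiff
    exact (hχ.comp contDiff_fst).mul ((this.comp contDiff_snd).mul (hG.comp contDiff_snd))
  have hφc : HasCompactSupport φ := by
    refine HasCompactSupport.intro (hχc.isCompact.prod η.hasCompactSupport.isCompact) ?_
    rintro ⟨x, t⟩ h
    by_cases hx : x ∈ tsupport χ
    · have : t ∉ tsupport η := fun ht => h ⟨hx, ht⟩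
      simp [hφ, image_eq_zero_of_notMem_tsupport this]
    · simp [hφ, image_eq_zero_of_notMem_tsupport hx]
  have hφt : tsupport φ ⊆ univ ×ˢ Iio T := by
    have : tsupport φ ⊆ Prod.snd ⁻¹' (Iic b) := by
      refine closure_minimal ?_ (isClosed_Iic.preimage continuous_snd)
      rintro ⟨x, t⟩ h
      by_contra h'
      simp only [mem_preimage, mem_Iic, not_le] at h'
      exact h (by simp [hφ, hb t h'])
    exact fun p hp => ⟨trivial, lt_of_le_of_lt (this hp) hbT⟩
  have key := hu.2.2 φ hφs hφc hφt
  have hder : ∀ x, ∀ t ∈ Ioo 0 T, fderiv ℝ φ (x, t) (0, 1) = χ x * g t ∧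
      fderiv ℝ φ (x, t) (1, 0) = deriv χ x * G t := by
    intro x t ht
    have h1 : HasDerivAt (fun s => η s * G s) (g t) t := by
      refine (hd t).congr_of_eventuallyEq ?_
      filter_upwards [hη1 t (Ioo_subset_Icc_self ht)] with s hs
      simp [hs]
    have h2 : HasDerivAt χ (deriv χ x) x := (hχ.differentiable (by simp) x).hasDerivAt
    have hf1 : HasFDerivAt (Prod.fst : ℝ × ℝ → ℝ) (ContinuousLinearMap.fst ℝ ℝ ℝ) (x, t) :=
      hasFDerivAt_fst
    have hf2 : HasFDerivAt (Prod.snd : ℝ × ℝ → ℝ) (ContinuousLinearMap.snd ℝ ℝ ℝ) (x, t) :=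
      hasFDerivAt_snd
    have h3 := (HasDerivAt.comp_hasFDerivAt (x, t) (f := Prod.fst) h2 hf1).mul
      (HasDerivAt.comp_hasFDerivAt (x, t) (f := Prod.snd) h1 hf2)
    have h4 : η t = 1 := (hη1 t (Ioo_subset_Icc_self ht)).eq_of_nhds
    have h5 : fderiv ℝ φ (x, t) = _ := HasFDerivAt.fderiv h3
    rw [h5]
    simp [h4, mul_comm]
  have h0 : η 0 = 1 := (hη1 0 ⟨le_rfl, hT.le⟩).eq_of_nhds
  refine Eq.trans ?_ key
  congr 1
  · refine setIntegral_congr_fun measurableSet_Ioo fun t ht => ?_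
    refine integral_congr_ae (Eventually.of_forall fun x => ?_)
    simp only [(hder x t ht).1, (hder x t ht).2]
  · simp [hφ, h0]

/-- integral evolution. For a weak solution with initial datum
`u₀(x) = −x^{−1/2}` (for `x > 0`, `0` otherwise), vanishing for a.e. `x < 0` and equal to
the stationary far-field profile `−x^{−1/2}` for a.e. `x > K`, the defect
`x ↦ u(x,t) + x^{−1/2}` is integrable on `(0,∞)` with integral `−t`, for a.e. `t ∈ (0,T)`. -/
theorem statement12 (T K : ℝ) (hT : 0 < T) (hK : 0 < K)
    (u₀ : ℝ → ℝ) (hu₀ : ∀ x : ℝ, u₀ x = if 0 < x then -(Real.sqrt x)⁻¹ else 0)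
    (u : ℝ × ℝ → ℝ) (hu : IsWeakSolution T u u₀)
    (hleft : ∀ᵐ p : ℝ × ℝ, p.1 < 0 → p.2 ∈ Ioo 0 T → u p = 0)
    (hfar : ∀ᵐ p : ℝ × ℝ, K < p.1 → p.2 ∈ Ioo 0 T → u p = -(Real.sqrt p.1)⁻¹) :
    ∀ᵐ t ∂(volume.restrict (Ioo 0 T)),
      IntegrableOn (fun x => u (x, t) + (Real.sqrt x)⁻¹) (Ioi 0) volume ∧
      ∫ x in Ioi (0 : ℝ), (u (x, t) + (Real.sqrt x)⁻¹) = -t := by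
  let χb : ContDiffBump (0 : ℝ) := ⟨K + 1, K + 2, by linarith, by linarith⟩
  obtain ⟨χ, hχdef⟩ : ∃ χ : ℝ → ℝ, χ = χb := ⟨_, rfl⟩
  have hχ : ContDiff ℝ ∞ χ := by rw [hχdef]; exact χb.contDiff
  have hχc : HasCompactSupport χ := by rw [hχdef]; exact χb.hasCompactSupport
  have hχ1 : ∀ x ∈ Icc 0 K, χ =ᶠ[nhds x] fun _ => (1 : ℝ) := fun x hx => by
    rw [hχdef]
    apply ContDiffBump.eventuallyEq_one_of_mem_ball
    rw [Metric.mem_ball, Real.dist_eq, sub_zero, abs_of_nonneg hx.1]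
    change x < K + 1
    linarith [hx.2]
  have hχe : ∀ x ∈ Icc 0 K, χ x = 1 := fun x hx => (hχ1 x hx).eq_of_nhds
  have hχd : ∀ x ∈ Icc 0 K, deriv χ x = 0 := fun x hx => by
    rw [(hχ1 x hx).deriv_eq]; simp
  clear_value χb
  have hL := aux_swap_ae hleft
  have hF := aux_swap_ae hfar
  have hne : ∀ᵐ x : ℝ, x ≠ 0 := by simp [ae_iff]
  have hS := aux_slice hu.1 hχ.continuous hχc
  have hW := aux_weight χ hχ.continuous hχc
  set M : ℝ → ℝ := fun t => ∫ x, u (x, t) * χ x with hM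
  have hMl : LocallyIntegrableOn M (Ioo 0 T) volume := aux_M_loc hu.1 hχ.continuous hχc
  set C : ℝ := ∫ x in Ioi (0 : ℝ), (Real.sqrt x)⁻¹ * χ x with hC
  have hC0 : ∫ x, u₀ x * χ x = - C := by
    rw [hC, ← integral_neg, ← integral_indicator measurableSet_Ioi]
    congr 1
    ext x
    by_cases hx : 0 < x <;> simp [hu₀, hx]
  have hflux : ∀ᵐ t ∂(volume.restrict (Ioo 0 T)), ∀ a b : ℝ,
      ∫ x : ℝ, (u (x, t) * (χ x * a) + x * (u (x, t)) ^ 2 * (deriv χ x * b))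
        = M t * a - b := by
    filter_upwards [hS, ae_restrict_of_ae hL, ae_restrict_of_ae hF,
      ae_restrict_mem measurableSet_Ioo] with t hSt hLt hFt ht a b
    have hdi : Integrable (deriv χ) volume :=
      (hχ.continuous_deriv (by simp)).integrable_of_hasCompactSupport hχc.deriv
    have e : (fun x : ℝ => u (x, t) * (χ x * a) + x * (u (x, t)) ^ 2 * (deriv χ x * b))
        =ᵐ[volume] fun x => u (x, t) * χ x * a + (Ioi K).indicator (deriv χ) x * b := by
      filter_upwards [hLt, hFt, hne] with x h1 h2 h3
      rcases lt_or_gt_of_ne h3 with h | h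
      · have : x ∉ Ioi K := fun h' => by have : K < x := h'; linarith
        simp [h1 h ht, this]
      · by_cases hxK : K < x
        · have : x * (u (x, t)) ^ 2 = 1 := by
            rw [h2 hxK ht, neg_sq, inv_pow, Real.sq_sqrt h.le, mul_inv_cancel₀ h3]
          rw [this, indicator_of_mem (show x ∈ Ioi K from hxK)]; ring
        · rw [indicator_of_notMem (show x ∉ Ioi K from hxK), hχd x ⟨h.le, not_lt.1 hxK⟩]; ring
    rw [integral_congr_ae e, integral_add (hSt.mul_const a)
      ((hdi.indicator measurableSet_Ioi).mul_const b), integral_mul_const, integral_mul_const,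
      integral_indicator measurableSet_Ioi,
      HasCompactSupport.integral_Ioi_deriv_eq (hχ.of_le (by simp)) hχc K,
      hχe K ⟨hK.le, le_rfl⟩]
    ring
  have hMeq : ∀ᵐ t, t ∈ Ioo 0 T → M t + t - (-C) = 0 := by
    have hcl : LocallyIntegrableOn (fun t : ℝ => t - (-C)) (Ioo 0 T) volume :=
      (continuous_id.sub continuous_const).continuousOn.locallyIntegrableOn measurableSet_Ioo
    have hl : LocallyIntegrableOn (fun t => M t + t - (-C)) (Ioo 0 T) volume := by
      have := hMl.add hcl
      refine this.congr ?_
      exact Eventually.of_forall fun t => by simp; ring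
    refine isOpen_Ioo.ae_eq_zero_of_integral_contDiff_smul_eq_zero hl ?_
    intro g hg hgc hgT
    obtain ⟨G, hG, hd, hG0, hGT, hz⟩ := aux_psi hT hg hgc hgT
    have key := aux_test hT hu hχ hχc hG hd hz
    have k1 : ∫ t in Ioo (0 : ℝ) T, ∫ x : ℝ, (u (x, t) * (χ x * g t)
          + x * (u (x, t)) ^ 2 * (deriv χ x * G t)) = ∫ t in Ioo (0 : ℝ) T, (M t * g t - G t) := by
      refine integral_congr_ae ?_
      filter_upwards [hflux] with t h
      exact h _ _
    have k2 : ∫ x : ℝ, u₀ x * (χ x * G 0) = - C * G 0 := by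
      rw [← hC0, ← integral_mul_const]
      simp only [mul_assoc]
    have hMg : IntegrableOn (fun t => M t * g t) (Ioo 0 T) volume := by
      have : IntegrableOn (fun t => M t * g t) (tsupport g) volume :=
        (hMl.integrableOn_compact_subset hgT hgc.isCompact).mul_continuousOn
          hg.continuous.continuousOn hgc.isCompact
      refine this.of_forall_sdiff_eq_zero measurableSet_Ioo ?_
      rintro t ⟨-, h⟩
      simp [image_eq_zero_of_notMem_tsupport h]
    have hci : ∀ f : ℝ → ℝ, Continuous f → IntegrableOn f (Ioo 0 T) volume := fun f hf =>
      (hf.continuousOn.integrableOn_Icc).mono_set Ioo_subset_Icc_self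
    have hio : ∀ f : ℝ → ℝ, ∫ t in Ioo 0 T, f t = ∫ t in 0..T, f t := fun f => by
      rw [intervalIntegral.integral_of_le hT.le, integral_Ioc_eq_integral_Ioo]
    have k3 : ∫ t in Ioo 0 T, G t = - ∫ t in Ioo 0 T, t * g t := by
      rw [hio, hio, intervalIntegral.integral_mul_deriv_eq_deriv_mul
        (u := fun t => t) (u' := fun _ => 1) (v := G) (v' := g)
        (fun t _ => hasDerivAt_id t) (fun t _ => hd t)
        (continuous_const.intervalIntegrable _ _) (hg.continuous.intervalIntegrable _ _)]
      simp [hGT]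
    rw [k1, k2, integral_sub hMg (hci G hG.continuous), k3, hG0, ← hio] at key
    have k4 : ∫ t, g t • (M t + t - (-C))
        = ∫ t in Ioo 0 T, (M t * g t + t * g t + C * g t) := by
      rw [← setIntegral_eq_integral_of_forall_compl_eq_zero (s := Ioo 0 T)]
      · congr 1; ext t; simp; ring
      · intro t ht
        simp [image_eq_zero_of_notMem_tsupport fun h => ht (hgT h)]
    have i1 : IntegrableOn (fun t => t * g t) (Ioo 0 T) volume :=
      hci _ (continuous_id.mul hg.continuous)
    have i2 : IntegrableOn (fun t => C * g t) (Ioo 0 T) volume :=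
      hci _ (continuous_const.mul hg.continuous)
    have i3 : IntegrableOn (fun t => M t * g t + t * g t) (Ioo 0 T) volume := hMg.add i1
    rw [k4, integral_add i3 i2, integral_add hMg i1, integral_const_mul]
    linarith
  filter_upwards [hS, ae_restrict_of_ae hL, ae_restrict_of_ae hF,
      ae_restrict_mem measurableSet_Ioo, ae_restrict_of_ae hMeq] with t hSt hLt hFt ht hMt
  have e : (fun x => u (x, t) + (Real.sqrt x)⁻¹) =ᵐ[volume.restrict (Ioi 0)]
      fun x => u (x, t) * χ x + (Real.sqrt x)⁻¹ * χ x := by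
    filter_upwards [ae_restrict_of_ae hFt, ae_restrict_mem measurableSet_Ioi] with x h1 h2
    by_cases hx : K < x
    · rw [h1 hx ht]; ring
    · rw [hχe x ⟨le_of_lt h2, not_lt.1 hx⟩]; ring
  have hMi : ∫ x in Ioi 0, u (x, t) * χ x = M t := by
    rw [hM, ← integral_indicator measurableSet_Ioi]
    refine integral_congr_ae ?_
    filter_upwards [hLt, hne] with x h1 h2
    rcases lt_or_gt_of_ne h2 with h | h
    · simp [h1 h ht]
    · rw [indicator_of_mem (show x ∈ Ioi 0 from h)]
  refine ⟨(hSt.integrableOn.add hW).congr e.symm, ?_⟩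
  rw [integral_congr_ae e, integral_add hSt.integrableOn hW, hMi]
  linarith [hMt ht]
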